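/- Let r ≥ 3 be an odd integer and C_r the cycle on vertices {1,…,r} with edges {i,i+1} (indices modulo r). Then I(C_r) = ⋂_{m ∈ M_e(C_r)} (supp(m)) ∩ ⋂_{{i,i+1} ∈ E(C_r)} (s_{i,i+1}, t_{i,i+1}), where (supp(m)) denotes the prime ideal generated by the variables dividing m, and this is the minimal primary decomposition of I(C_r). -/

import Mathlib

open MvPolynomial

/-- Indicator: does the edge `e` cross the partition `A | Aᶜ`? -/
def crossBool {V : Type} [DecidableEq V] (A : Finset V) : Sym2 V → Bool :=
  Sym2.lift ⟨fun i j => xor (decide (i ∈ A)) (decide (j ∈ A)), fun i j => Bool.xor_comm _ _⟩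

/-- The cut monomial `u_{A|B}` (with `B = Aᶜ`), formed from the edges in `E'`,
viewed in the polynomial ring `S` on variables `s_e = X (e, true)`, `t_e = X (e, false)`
indexed by the edges of the ambient graph `G`. -/
noncomputable def cutGen (k : Type) [Field k] {V : Type} [DecidableEq V]
    (G : SimpleGraph V) (E' : Finset (Sym2 V)) (hE' : ↑E' ⊆ G.edgeSet) (A : Finset V) :
    MvPolynomial (↥G.edgeSet × Bool) k :=
  ∏ e ∈ E'.attach, X (⟨⟨e.1, hE' e.2⟩, crossBool A e.1⟩ : ↥G.edgeSet × Bool)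

/-- The monomial cut ideal of the subgraph of `G` with edge set `E'`,
viewed as an ideal of the polynomial ring associated to `G`. -/
noncomputable def cutIdealOn (k : Type) [Field k] {V : Type} [DecidableEq V]
    (G : SimpleGraph V) (E' : Finset (Sym2 V)) (hE' : ↑E' ⊆ G.edgeSet) :
    Ideal (MvPolynomial (↥G.edgeSet × Bool) k) :=
  Ideal.span (Set.range (cutGen k G E' hE'))

/-- The monomial cut ideal `I(G)` of the graph `G`. -/
noncomputable def cutIdeal (k : Type) [Field k] {V : Type} [DecidableEq V]
    (G : SimpleGraph V) [Fintype G.edgeSet] :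
    Ideal (MvPolynomial (↥G.edgeSet × Bool) k) :=
  cutIdealOn k G G.edgeSet.toFinset (by simp)

/-- The exponent vectors of the monomials in `M_e(C_r)`: squarefree, of total degree `r`,
with even `s`-degree, and divisible by no product `s_e * t_e`. -/
def MeExp (r : ℕ) [Fintype (SimpleGraph.cycleGraph r).edgeSet] :
    Set ((↥(SimpleGraph.cycleGraph r).edgeSet × Bool) →₀ ℕ) :=
  {d | (∀ v, d v ≤ 1) ∧ (d.sum fun _ n => n) = r ∧
    Even (∑ e : ↥(SimpleGraph.cycleGraph r).edgeSet, d (e, true)) ∧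
    ∀ e : ↥(SimpleGraph.cycleGraph r).edgeSet, ¬ (d (e, true) ≠ 0 ∧ d (e, false) ≠ 0)}

section CutHelpers

lemma spanX_isPrime (k : Type) [Field k] {σ : Type} (W : Set σ) :
    (Ideal.span ((fun v => (X v : MvPolynomial σ k)) '' W)).IsPrime := by
  classical
  let φ : MvPolynomial σ k →ₐ[k] MvPolynomial σ k := aeval fun v => if v ∈ W then 0 else X v
  set I := Ideal.span ((fun v => (X v : MvPolynomial σ k)) '' W) with hI
  have hle : I ≤ RingHom.ker φ := by
    rw [hI, Ideal.span_le]
    rintro _ ⟨v, hv, rfl⟩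
    simp [φ, RingHom.mem_ker, hv]
  have hcomp : (Ideal.Quotient.mkₐ k I).comp φ = Ideal.Quotient.mkₐ k I := by
    apply MvPolynomial.algHom_ext
    intro v
    by_cases hv : v ∈ W
    · have : (X v : MvPolynomial σ k) ∈ I := Ideal.subset_span ⟨v, hv, rfl⟩
      simp [φ, hv, (Ideal.Quotient.eq_zero_iff_mem.mpr this)]
    · simp [φ, hv]
  have : I = RingHom.ker φ := by
    apply le_antisymm hle
    intro x hx
    have h2 := DFunLike.congr_fun hcomp x
    rw [AlgHom.comp_apply, (RingHom.mem_ker).mp hx, map_zero] at h2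
    exact Ideal.Quotient.eq_zero_iff_mem.mp h2.symm
  rw [this]
  exact RingHom.ker_isPrime _

lemma X_mem_spanX (k : Type) [Field k] {σ : Type} (W : Set σ) (v : σ) :
    (X v : MvPolynomial σ k) ∈ Ideal.span ((fun v => (X v : MvPolynomial σ k)) '' W) ↔ v ∈ W := by
  classical
  rw [mem_ideal_span_X_image]
  constructor
  · intro h
    obtain ⟨i, hi, hne⟩ := h (Finsupp.single v 1) (by simp [mem_support_iff])
    have : v = i := by
      by_contra hvi
      exact hne (by simp [Finsupp.single_apply, hvi])
    exact this ▸ hi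
  · intro h m hm
    rw [support_X, Finset.mem_singleton] at hm
    exact ⟨v, h, by simp [hm]⟩

lemma spanX_le_spanX (k : Type) [Field k] {σ : Type} (W W' : Set σ)
    (h : Ideal.span ((fun v => (X v : MvPolynomial σ k)) '' W) ≤
      Ideal.span ((fun v => (X v : MvPolynomial σ k)) '' W')) : W ⊆ W' := by
  intro v hv
  rw [← X_mem_spanX k W' v]
  exact h ((X_mem_spanX k W v).mpr hv)

/-- Parity of a choice of `s`/`t` for each edge. -/
def par {E : Type} [Fintype E] (f : E → Bool) : ZMod 2 := ∑ e, (if f e then 1 else 0)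

lemma par_update {E : Type} [Fintype E] [DecidableEq E] (f : E → Bool) (e : E) :
    par (Function.update f e (!f e)) = par f + 1 := by
  unfold par
  rw [← Finset.add_sum_erase _ _ (Finset.mem_univ e), ← Finset.add_sum_erase _ (fun e => if f e then (1 : ZMod 2) else 0) (Finset.mem_univ e)]
  have : ∑ x ∈ Finset.univ.erase e, (if Function.update f e (!f e) x then (1 : ZMod 2) else 0)
      = ∑ x ∈ Finset.univ.erase e, (if f x then (1 : ZMod 2) else 0) := by
    apply Finset.sum_congr rfl
    intro x hx
    rw [Function.update_of_ne (Finset.ne_of_mem_erase hx)]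
  rw [this]
  have h2 : (1 : ZMod 2) + 1 = 0 := by decide
  cases h : f e
  · simp; ring
  · simp
    linear_combination - h2

lemma par_not {E : Type} [Fintype E] (f : E → Bool) :
    par (fun e => !f e) = Fintype.card E + par f := by
  have : ∀ b : Bool, (if (!b) = true then (1 : ZMod 2) else 0) = 1 + (if b = true then 1 else 0) := by
    decide
  unfold par
  simp_rw [this, Finset.sum_add_distrib]
  simp

lemma zmod2_cases (x : ZMod 2) : x = 0 ∨ x = 1 := by revert x; decide

/-- The combinatorial core. -/
lemma cover_core {E : Type} [Fintype E] (hodd : Odd (Fintype.card E)) (Q : E × Bool → Prop)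
    (h : ∀ f : E → Bool, par f = 0 → ∃ e, ¬ Q (e, f e)) :
    (∃ e, ¬ Q (e, true) ∧ ¬ Q (e, false)) ∨
      ∃ g : E → Bool, par g = 0 ∧ ∀ v : E × Bool, v.2 = g v.1 → ¬ Q v := by
  classical
  by_contra hcon
  push Not at hcon
  obtain ⟨h1, h2⟩ := hcon
  have : ∀ e, ∃ b, Q (e, b) := by
    intro e
    by_cases ht : Q (e, true)
    · exact ⟨_, ht⟩
    · exact ⟨_, h1 e ht⟩
  choose f hf using this
  rcases zmod2_cases (par f) with h0 | hp
  · obtain ⟨e, he⟩ := h f h0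
    exact he (hf e)
  · have hn : par (fun e => !f e) = 0 := by
      rw [par_not, hp, (ZMod.natCast_eq_one_iff_odd).mpr hodd]; decide
    obtain ⟨⟨e, b⟩, hv, hQ⟩ := h2 _ hn
    simp only at hv
    subst hv
    obtain ⟨e', he'⟩ := h (Function.update f e (!f e)) (by rw [par_update, hp]; decide)
    apply he'
    by_cases hee : e' = e
    · subst hee; simpa using hQ
    · rw [Function.update_of_ne hee]; exact hf e'

/-- The edge `{i, i+1}` of the cycle. -/
def cycEdge (n : ℕ) (i : Fin (n + 3)) : ↥(SimpleGraph.cycleGraph (n + 3)).edgeSet :=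
  ⟨s(i, i + 1), by
    rw [SimpleGraph.mem_edgeSet, SimpleGraph.cycleGraph_adj]
    right; abel⟩

lemma cycEdge_bij (n : ℕ) : Function.Bijective (cycEdge n) := by
  constructor
  · intro i j hij
    have := congrArg Subtype.val hij
    simp only [cycEdge, Sym2.eq_iff] at this
    rcases this with h | ⟨h1, h2⟩
    · exact h.1
    · exfalso
      have h3 : j + (1 + 1) = j + 0 := by rw [← add_assoc, ← h1, h2, add_zero]
      have h4 := add_left_cancel h3
      have h5 := congrArg Fin.val h4
      simp [Fin.val_add] at h5
      rw [Nat.mod_eq_of_lt (by omega)] at h5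
      omega
  · rintro ⟨e, he⟩
    induction e using Sym2.ind with
    | _ u v =>
      rw [SimpleGraph.mem_edgeSet, SimpleGraph.cycleGraph_adj] at he
      rcases he with h | h
      · refine ⟨v, Subtype.ext ?_⟩
        simp only [cycEdge]
        rw [← h, Sym2.eq_swap]; congr 1; simp
      · refine ⟨u, Subtype.ext ?_⟩
        simp only [cycEdge]
        rw [← h]; simp

lemma card_cyc (n : ℕ) [Fintype (SimpleGraph.cycleGraph (n + 3)).edgeSet] :
    Fintype.card ↥(SimpleGraph.cycleGraph (n + 3)).edgeSet = n + 3 := by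
  rw [← Fintype.card_of_bijective (cycEdge_bij n), Fintype.card_fin]

lemma crossBool_cycEdge (n : ℕ) (A : Finset (Fin (n + 3))) (i : Fin (n + 3)) :
    crossBool A (cycEdge n i).1 = xor (decide (i ∈ A)) (decide (i + 1 ∈ A)) := rfl

lemma par_cyc (n : ℕ) [Fintype (SimpleGraph.cycleGraph (n + 3)).edgeSet]
    (f : ↥(SimpleGraph.cycleGraph (n + 3)).edgeSet → Bool) :
    par f = par (fun i => f (cycEdge n i)) := by
  unfold par
  exact (Function.Bijective.sum_comp (cycEdge_bij n) (fun e => if f e then (1 : ZMod 2) else 0)).symm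

lemma par_cross (n : ℕ) [Fintype (SimpleGraph.cycleGraph (n + 3)).edgeSet]
    (A : Finset (Fin (n + 3))) :
    par (fun e : ↥(SimpleGraph.cycleGraph (n + 3)).edgeSet => crossBool A e.1) = 0 := by
  rw [par_cyc]
  simp_rw [crossBool_cycEdge]
  have : ∀ a b : Bool, (if (xor a b) = true then (1 : ZMod 2) else 0) =
      (if a = true then 1 else 0) + (if b = true then 1 else 0) := by decide
  unfold par
  simp_rw [this, Finset.sum_add_distrib]
  have hshift : ∑ x : Fin (n + 3), (if decide (x + 1 ∈ A) = true then (1 : ZMod 2) else 0) =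
      ∑ i : Fin (n + 3), (if decide (i ∈ A) = true then (1 : ZMod 2) else 0) :=
    Equiv.sum_comp (Equiv.addRight (1 : Fin (n + 3)))
      (fun i => if decide (i ∈ A) = true then (1 : ZMod 2) else 0)
  rw [hshift]
  exact CharTwo.add_self_eq_zero _

lemma exists_cut (n : ℕ) [Fintype (SimpleGraph.cycleGraph (n + 3)).edgeSet]
    (f : ↥(SimpleGraph.cycleGraph (n + 3)).edgeSet → Bool) (hf : par f = 0) :
    ∃ A : Finset (Fin (n + 3)), ∀ e : ↥(SimpleGraph.cycleGraph (n + 3)).edgeSet,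
      crossBool A e.1 = f e := by
  classical
  rw [par_cyc] at hf
  let a : ℕ → ZMod 2 := fun j => if h : j < n + 3 then (if f (cycEdge n ⟨j, h⟩) then 1 else 0) else 0
  let P : ℕ → ZMod 2 := fun j => ∑ i ∈ Finset.range j, a i
  have hP : P (n + 3) = 0 := by
    rw [← hf]
    unfold par
    simp only [P]
    rw [Finset.sum_range]
    simp [a]
  have hP0 : P 0 = 0 := by simp [P]
  have hstep : ∀ i : Fin (n + 3), P ((i + 1 : Fin (n + 3)) : ℕ) =
      P i + (if f (cycEdge n i) then 1 else 0) := by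
    intro i
    have h1 : P (i.1 + 1) = P i + (if f (cycEdge n i) then 1 else 0) := by
      simp only [P]
      rw [Finset.sum_range_succ]
      simp [a]
    rw [← h1]
    by_cases hi : i.1 + 1 < n + 3
    · congr 1
      rw [Fin.val_add, Fin.val_one, Nat.mod_eq_of_lt hi]
    · have hi' : i.1 + 1 = n + 3 := by omega
      rw [Fin.val_add, Fin.val_one, hi', Nat.mod_self, hP, hP0]
  refine ⟨Finset.univ.filter (fun j => P j.1 = 1), ?_⟩
  intro e
  obtain ⟨i, rfl⟩ := (cycEdge_bij n).2 e
  rw [crossBool_cycEdge]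
  simp only [Finset.mem_filter, Finset.mem_univ, true_and, hstep]
  have : ∀ (x : ZMod 2) (b : Bool),
    xor (decide (x = 1)) (decide (x + (if b = true then 1 else 0) = 1)) = b := by decide
  exact this _ _

/-- The monomial attached to a choice function. -/
noncomputable def selMon (k : Type) [Field k] {E : Type} [Fintype E] (f : E → Bool) :
    MvPolynomial (E × Bool) k := ∏ e, X (e, f e)

lemma cutGen_eq (k : Type) [Field k] {V : Type} [DecidableEq V] (G : SimpleGraph V)
    [Fintype G.edgeSet] (h) (A : Finset V) :
    cutGen k G G.edgeSet.toFinset h A = selMon k (fun e : ↥G.edgeSet => crossBool A e.1) := by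
  unfold cutGen selMon
  refine Finset.prod_bij (fun e _ => ⟨e.1, h e.2⟩) ?_ ?_ ?_ ?_
  · intros; exact Finset.mem_univ _
  · intro a _ b _ hab
    exact Subtype.ext (Subtype.mk.inj hab)
  · intro b _
    exact ⟨⟨b.1, Set.mem_toFinset.mpr b.2⟩, Finset.mem_attach _ _, rfl⟩
  · intros; rfl

lemma cutIdeal_cyc (k : Type) [Field k] (n : ℕ)
    [Fintype (SimpleGraph.cycleGraph (n + 3)).edgeSet] :
    cutIdeal k (SimpleGraph.cycleGraph (n + 3)) =
      Ideal.span (selMon k '' {f : ↥(SimpleGraph.cycleGraph (n + 3)).edgeSet → Bool | par f = 0}) := by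
  unfold cutIdeal cutIdealOn
  congr 1
  ext x
  simp only [Set.mem_range, Set.mem_image, Set.mem_ofPred_eq, cutGen_eq]
  constructor
  · rintro ⟨A, rfl⟩
    exact ⟨_, par_cross n A, rfl⟩
  · rintro ⟨f, hf, rfl⟩
    obtain ⟨A, hA⟩ := exists_cut n f hf
    exact ⟨A, by simp_rw [hA]⟩

lemma MeExp_forward (n : ℕ) [Fintype (SimpleGraph.cycleGraph (n + 3)).edgeSet]
    (d) (hd : d ∈ MeExp (n + 3)) :
    ∃ g : ↥(SimpleGraph.cycleGraph (n + 3)).edgeSet → Bool, par g = 0 ∧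
      {v | d v ≠ 0} = {v | v.2 = g v.1} := by
  classical
  obtain ⟨h1, h2, h3, h4⟩ := hd
  rw [Finsupp.sum_fintype _ _ (fun _ => rfl), Fintype.sum_prod_type] at h2
  simp only [Fintype.sum_bool] at h2
  have hle : ∀ e, d (e, true) + d (e, false) ≤ 1 := by
    intro e
    have := h1 (e, true)
    have := h1 (e, false)
    have := h4 e
    omega
  have heq : ∀ e, d (e, true) + d (e, false) = 1 := by
    have := (Finset.sum_eq_sum_iff_of_le (s := Finset.univ) (fun e _ => hle e)).mp
      (by rw [h2, ← Finset.card_eq_sum_ones, Finset.card_univ, card_cyc])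
    intro e
    exact this e (Finset.mem_univ e)
  refine ⟨fun e => decide (d (e, true) = 1), ?_, ?_⟩
  · rw [← ZMod.natCast_eq_zero_iff_even] at h3
    rw [← h3]
    unfold par
    push_cast
    apply Finset.sum_congr rfl
    intro e _
    have := heq e
    rcases Nat.lt_or_ge (d (e, true)) 1 with h | h
    · have h0 : d (e, true) = 0 := by omega
      simp [h0]
    · have h0 : d (e, true) = 1 := by omega
      simp [h0]
  · ext ⟨e, b⟩
    have := heq e
    cases b
    · simp only [Set.mem_ofPred_eq]
      rw [eq_comm, decide_eq_false_iff_not]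
      omega
    · simp only [Set.mem_ofPred_eq]
      rw [eq_comm, decide_eq_true_iff]
      omega

lemma MeExp_backward (n : ℕ) [Fintype (SimpleGraph.cycleGraph (n + 3)).edgeSet]
    (g : ↥(SimpleGraph.cycleGraph (n + 3)).edgeSet → Bool) (hg : par g = 0) :
    ∃ d ∈ MeExp (n + 3), {v | d v ≠ 0} = {v | v.2 = g v.1} := by
  classical
  refine ⟨Finsupp.equivFunOnFinite.symm (fun v => if v.2 = g v.1 then 1 else 0), ⟨?_, ?_, ?_, ?_⟩, ?_⟩
  · intro v
    simp only [Finsupp.equivFunOnFinite_symm_apply_apply]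
    split_ifs <;> omega
  · rw [Finsupp.sum_fintype _ _ (fun _ => rfl), Fintype.sum_prod_type]
    simp only [Finsupp.equivFunOnFinite_symm_apply_apply, Fintype.sum_bool]
    refine Eq.trans ?_ (card_cyc n)
    rw [← Finset.card_univ, Finset.card_eq_sum_ones]
    apply Finset.sum_congr rfl
    intro e _
    cases g e <;> simp
  · rw [← ZMod.natCast_eq_zero_iff_even, ← hg]
    unfold par
    push_cast
    apply Finset.sum_congr rfl
    intro e _
    simp only [Finsupp.equivFunOnFinite_symm_apply_apply]
    cases g e <;> simp
  · intro e
    simp only [Finsupp.equivFunOnFinite_symm_apply_apply]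
    cases g e <;> simp
  · ext v
    simp

lemma selMon_eq_monomial (k : Type) [Field k] {E : Type} [Fintype E] (f : E → Bool) :
    selMon k f = monomial (∑ e, Finsupp.single (e, f e) 1) (1 : k) := by
  classical
  unfold selMon
  rw [monomial_sum_one]
  rfl

lemma mem_span_selMon (k : Type) [Field k] {E : Type} [Fintype E] (S : Set (E → Bool))
    (x : MvPolynomial (E × Bool) k)
    (h : ∀ m ∈ x.support, ∃ f ∈ S, ∀ e, m (e, f e) ≠ 0) :
    x ∈ Ideal.span (selMon k '' S) := by
  classical
  have himg : selMon k '' S = (fun s => monomial s (1 : k)) ''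
      ((fun f : E → Bool => ∑ e, Finsupp.single (e, f e) 1) '' S) := by
    rw [Set.image_image]
    apply Set.image_congr
    intro f _
    exact selMon_eq_monomial k f
  rw [himg, mem_ideal_span_monomial_image]
  intro m hm
  obtain ⟨f, hf, hfm⟩ := h m hm
  refine ⟨_, ⟨f, hf, rfl⟩, ?_⟩
  rintro ⟨e, b⟩
  simp only [Finsupp.finsetSum_apply]
  rw [Finset.sum_eq_single e]
  · rw [Finsupp.single_apply]
    split_ifs with hb
    · have := hfm e
      rw [hb] at this
      omega
    · omega
  · intro e' _ hne
    rw [Finsupp.single_apply, if_neg]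
    intro hh
    exact hne (congrArg Prod.fst hh)
  · intro hh; exact absurd (Finset.mem_univ e) hh

lemma pair_eq_image (k : Type) [Field k] {E : Type} (e : E) :
    ({X (e, true), X (e, false)} : Set (MvPolynomial (E × Bool) k)) =
      (fun v => (X v : MvPolynomial (E × Bool) k)) '' {v | v.1 = e} := by
  ext x
  constructor
  · rintro (rfl | rfl)
    · exact ⟨(e, true), rfl, rfl⟩
    · exact ⟨(e, false), rfl, rfl⟩
  · rintro ⟨⟨e', b⟩, he, rfl⟩
    simp only [Set.mem_ofPred_eq] at he
    subst he
    cases b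
    · right; rfl
    · left; rfl

lemma span_selMon_le (k : Type) [Field k] {E : Type} [Fintype E]
    (W : Set (E × Bool)) (h : ∀ f : E → Bool, par f = 0 → ∃ e, (e, f e) ∈ W) :
    Ideal.span (selMon k '' {f : E → Bool | par f = 0}) ≤
      Ideal.span ((fun v => (X v : MvPolynomial (E × Bool) k)) '' W) := by
  rw [Ideal.span_le]
  rintro _ ⟨f, hf, rfl⟩
  obtain ⟨e, he⟩ := h f hf
  exact Ideal.mem_of_dvd _ (Finset.dvd_prod_of_mem (fun e => (X (e, f e) : MvPolynomial (E × Bool) k)) (Finset.mem_univ e))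
    (Ideal.subset_span ⟨_, he, rfl⟩)

lemma hit_of_even {E : Type} [Fintype E] (hodd : Odd (Fintype.card E)) (g : E → Bool)
    (hg : par g = 0) (f : E → Bool) (hf : par f = 0) : ∃ e, f e = g e := by
  by_contra hcon
  push Not at hcon
  have : f = fun e => !g e := by
    funext e
    have := hcon e
    revert this
    cases f e <;> cases g e <;> simp
  rw [this, par_not, hg, (ZMod.natCast_eq_one_iff_odd).mpr hodd] at hf
  revert hf; decide

end CutHelpers

/-- For an odd cycle `C_r` (`r ≥ 3` odd), the minimal primary decomposition of `I(C_r)` is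
`I(C_r) = ⋂_{m ∈ M_e(C_r)} (supp m) ∩ ⋂_{e ∈ E(C_r)} (s_e, t_e)`; minimality is expressed
by the fact that the minimal primes of `I(C_r)` are exactly the primes occurring. -/
theorem monomial_cut_ideal_odd_cycle_primary_decomposition
    (k : Type) [Field k] (r : ℕ) (hr : 3 ≤ r) (hodd : Odd r)
    [DecidableRel (SimpleGraph.cycleGraph r).Adj]
    [Fintype (SimpleGraph.cycleGraph r).edgeSet] :
    cutIdeal k (SimpleGraph.cycleGraph r) =
      (⨅ d ∈ MeExp r,
        Ideal.span ((fun v => (X v : MvPolynomial (↥(SimpleGraph.cycleGraph r).edgeSet × Bool) k))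
          '' {v | d v ≠ 0})) ⊓
      (⨅ e : ↥(SimpleGraph.cycleGraph r).edgeSet,
        Ideal.span {X ((e, true) : ↥(SimpleGraph.cycleGraph r).edgeSet × Bool),
                    X ((e, false) : ↥(SimpleGraph.cycleGraph r).edgeSet × Bool)}) ∧
    (cutIdeal k (SimpleGraph.cycleGraph r)).minimalPrimes =
      {p | ∃ d ∈ MeExp r,
        p = Ideal.span ((fun v => (X v : MvPolynomial (↥(SimpleGraph.cycleGraph r).edgeSet × Bool) k))
          '' {v | d v ≠ 0})} ∪
      Set.range (fun e : ↥(SimpleGraph.cycleGraph r).edgeSet =>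
        Ideal.span {X ((e, true) : ↥(SimpleGraph.cycleGraph r).edgeSet × Bool),
                    X ((e, false) : ↥(SimpleGraph.cycleGraph r).edgeSet × Bool)}) := by
  obtain ⟨n, rfl⟩ : ∃ n, r = n + 3 := ⟨r - 3, by omega⟩
  have hcard := card_cyc n
  have hoddE : Odd (Fintype.card ↥(SimpleGraph.cycleGraph (n + 3)).edgeSet) := by rw [hcard]; exact hodd
  simp_rw [pair_eq_image]
  have hleE : ∀ e : ↥(SimpleGraph.cycleGraph (n + 3)).edgeSet,
      cutIdeal k (SimpleGraph.cycleGraph (n + 3)) ≤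
      Ideal.span ((fun v => (X v : MvPolynomial (↥(SimpleGraph.cycleGraph (n + 3)).edgeSet × Bool) k))
          '' {v | v.1 = e}) := by
    intro e
    rw [cutIdeal_cyc]
    exact span_selMon_le k _ (fun f _ => ⟨e, rfl⟩)
  have hleD : ∀ d ∈ MeExp (n + 3),
      cutIdeal k (SimpleGraph.cycleGraph (n + 3)) ≤
      Ideal.span ((fun v => (X v : MvPolynomial (↥(SimpleGraph.cycleGraph (n + 3)).edgeSet × Bool) k))
          '' {v | d v ≠ 0}) := by
    intro d hd
    obtain ⟨g, hg, hdg⟩ := MeExp_forward n d hd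
    rw [cutIdeal_cyc, hdg]
    exact span_selMon_le k _ (fun f hf => hit_of_even hoddE g hg f hf)
  constructor
  · apply le_antisymm
    · exact le_inf (le_iInf₂ hleD) (le_iInf hleE)
    · intro x hx
      obtain ⟨hx1, hx2⟩ := Submodule.mem_inf.mp hx
      simp only [Ideal.mem_iInf] at hx1 hx2
      rw [cutIdeal_cyc]
      apply mem_span_selMon
      intro m hm
      by_contra hcon
      simp only [Set.mem_ofPred_eq] at hcon
      push Not at hcon
      rcases cover_core hoddE (fun v => m v ≠ 0) (by simpa using hcon) with ⟨e, he1, he2⟩ | ⟨g, hg, hgm⟩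
      · obtain ⟨⟨e', b⟩, hv, hne⟩ := mem_ideal_span_X_image.mp (hx2 e) m hm
        simp only [Set.mem_ofPred_eq] at hv
        subst hv
        cases b
        · exact he2 hne
        · exact he1 hne
      · obtain ⟨d, hd, hdg⟩ := MeExp_backward n g hg
        have := hx1 d hd
        rw [hdg] at this
        obtain ⟨v, hv, hne⟩ := mem_ideal_span_X_image.mp this m hm
        exact hgm v hv hne
  · have hcontain : ∀ p : Ideal (MvPolynomial (↥(SimpleGraph.cycleGraph (n + 3)).edgeSet × Bool) k),
        p.IsPrime → cutIdeal k (SimpleGraph.cycleGraph (n + 3)) ≤ p →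
        (∃ e, Ideal.span ((fun v => (X v : MvPolynomial (↥(SimpleGraph.cycleGraph (n + 3)).edgeSet × Bool) k))
          '' {v | v.1 = e}) ≤ p) ∨
        ∃ d ∈ MeExp (n + 3), Ideal.span ((fun v => (X v : MvPolynomial (↥(SimpleGraph.cycleGraph (n + 3)).edgeSet × Bool) k))
          '' {v | d v ≠ 0}) ≤ p := by
      intro p hp hle
      rcases cover_core hoddE (fun v => (X v : MvPolynomial _ k) ∉ p) (by
        intro f hf
        have : selMon k f ∈ p := by
          apply hle
          rw [cutIdeal_cyc]
          exact Ideal.subset_span ⟨f, hf, rfl⟩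
        obtain ⟨e, _, he⟩ := (Ideal.IsPrime.prod_mem_iff (hp := hp)).mp this
        exact ⟨e, not_not.mpr he⟩) with ⟨e, he1, he2⟩ | ⟨g, hg, hgm⟩
      · left
        refine ⟨e, ?_⟩
        rw [Ideal.span_le]
        rintro _ ⟨⟨e', b⟩, hv, rfl⟩
        simp only [Set.mem_ofPred_eq] at hv
        subst hv
        cases b
        · exact not_not.mp he2
        · exact not_not.mp he1
      · right
        obtain ⟨d, hd, hdg⟩ := MeExp_backward n g hg
        refine ⟨d, hd, ?_⟩
        rw [hdg, Ideal.span_le]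
        rintro _ ⟨v, hv, rfl⟩
        exact not_not.mp (hgm v hv)
    ext q
    constructor
    · intro hq
      have hqmin := hq.2
      rcases hcontain q hq.1.1 hq.1.2 with ⟨e, he⟩ | ⟨d, hd, hdq⟩
      · right
        exact ⟨e, le_antisymm he (hqmin ⟨spanX_isPrime k _, hleE e⟩ he)⟩
      · left
        exact ⟨d, hd, le_antisymm (hqmin ⟨spanX_isPrime k _, hleD d hd⟩ hdq) hdq⟩
    · rintro (⟨d, hd, rfl⟩ | ⟨e, rfl⟩)
      · refine ⟨⟨spanX_isPrime k _, hleD d hd⟩, ?_⟩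
        intro p hp hpq
        obtain ⟨g, hg, hdg⟩ := MeExp_forward n d hd
        rcases hcontain p hp.1 hp.2 with ⟨e, he⟩ | ⟨d', hd', hdp⟩
        · exfalso
          have hsub := spanX_le_spanX k _ _ (he.trans hpq)
          rw [hdg] at hsub
          have h1 : true = g e := hsub (show ((e, true) : _ × Bool) ∈ {v | v.1 = e} from rfl)
          have h2 : false = g e := hsub (show ((e, false) : _ × Bool) ∈ {v | v.1 = e} from rfl)
          rw [← h2] at h1
          exact absurd h1 (by decide)
        · obtain ⟨g', hg', hdg'⟩ := MeExp_forward n d' hd'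
          have hsub := spanX_le_spanX k _ _ (hdp.trans hpq)
          rw [hdg, hdg'] at hsub
          have hgg : g' = g := by
            funext e
            exact hsub (show ((e, g' e) : _ × Bool) ∈ {v | v.2 = g' v.1} from rfl)
          rw [hdg, ← hgg, ← hdg']
          exact hdp
      · refine ⟨⟨spanX_isPrime k _, hleE e⟩, ?_⟩
        intro p hp hpq
        rcases hcontain p hp.1 hp.2 with ⟨e', he⟩ | ⟨d', hd', hdp⟩
        · have hsub := spanX_le_spanX k _ _ (he.trans hpq)
          have h1 : e' = e := hsub (show ((e', true) : _ × Bool) ∈ {v | v.1 = e'} from rfl)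
          subst h1
          exact he
        · exfalso
          obtain ⟨g', hg', hdg'⟩ := MeExp_forward n d' hd'
          have hsub := spanX_le_spanX k _ _ (hdp.trans hpq)
          rw [hdg'] at hsub
          obtain ⟨e', hne⟩ := Fintype.exists_ne_of_one_lt_card (by rw [hcard]; omega) e
          exact hne (hsub (show ((e', g' e') : _ × Bool) ∈ {v | v.2 = g' v.1} from rfl))
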